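/- arXiv:2601.21017 — 2 statements merged into one kernel-verified Lean document; each statement's English description precedes it below -/
import Mathlib

section
/- Let n ≥ 3 be an integer, a ∈ [0,1), b ∈ (−∞, n], and t0 ≥ 4. Let v : ℝ → [0,∞) with v(s) = 0 for s < t0, and set f(z,s) := v(s) |z|^{−b} (log|z|)^{−a} 𝟙_{{|z| ≥ √s}}. Then there is a constant C depending only on n, a, b (independent of t0) such that for all t ≥ t0: (i) if |x| ≤ √t, then T_n^out[f](x,t) ≤ C [ t^{−n/2} ( ∫_{t0/2}^{t/2} v(s) ds ) · D(t) + t^{1−b/2} (log t)^{−a} sup_{t/2 ≤ s ≤ t} v(s) ], where D(t) := t^{(n−b)/2} (log t)^{−a} if b < n and D(t) := (log t)^{1−a} if b = n; (ii) if |x| > √t, then T_n^out[f](x,t) ≤ C [ |x|^{−b} (log t)^{−a} ( t · sup_{t/2 ≤ s ≤ t} v(s) + ∫_{t0/2}^{t/2} v(s) ds ) + E(x,t) · t^{−n/2} e^{−|x|²/(16t)} ∫_{t0/2}^{t/2} v(s) ds ], where E(x,t) := 0 if b < n and E(x,t) := (log|x|)^{1−a} if b = n. -/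
open MeasureTheory

/-- The Duhamel heat propagator `T_n^out` with zero initial data at time `t0`. -/
noncomputable def Tout (n : ℕ) (t0 : ℝ) (f : EuclideanSpace ℝ (Fin n) → ℝ → ℝ)
    (x : EuclideanSpace ℝ (Fin n)) (t : ℝ) : ℝ :=
  ∫ s in t0..t, ∫ z, (4 * Real.pi * (t - s)) ^ (-(n : ℝ) / 2)
    * Real.exp (-‖x - z‖ ^ 2 / (4 * (t - s))) * f z s

theorem aux_exp (p : ℝ) (hp : 0 ≤ p) : ∃ C : ℝ, 0 < C ∧ ∀ M : ℝ, 0 ≤ M →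
    (2 * (1 + M)) ^ p ≤ C * Real.exp (M ^ 2 / 8) := by
  refine ⟨Real.exp (2 * p + 8 * p ^ 2), Real.exp_pos _, fun M hM => ?_⟩
  rw [← Real.exp_add]
  have h1 : (2 * (1 + M)) ≤ Real.exp (2 * (1 + M)) := by
    have := Real.add_one_le_exp (2 * (1 + M)); linarith
  calc (2 * (1 + M)) ^ p ≤ (Real.exp (2 * (1 + M))) ^ p :=
        Real.rpow_le_rpow (by positivity) h1 hp
    _ = Real.exp (2 * (1 + M) * p) := by rw [← Real.exp_mul]
    _ ≤ _ := by
        apply Real.exp_le_exp.mpr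
        nlinarith [sq_nonneg (M - 8 * p)]

/-- ratio bound -/
theorem aux_ratio (b : ℝ) : ∃ C : ℝ, 0 < C ∧ ∀ M R r : ℝ, 0 ≤ M → 0 < R → 0 < r →
    R ≤ 2 * (1 + M) * r → r ≤ 2 * (1 + M) * R →
    r ^ (-b) ≤ C * R ^ (-b) * Real.exp (M ^ 2 / 8) := by
  obtain ⟨C, hC, h⟩ := aux_exp |b| (abs_nonneg b)
  refine ⟨C, hC, fun M R r hM hR hr h1 h2 => ?_⟩
  have h3 := h M hM
  have hA : 0 < 2 * (1 + M) := by positivity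
  have key : r ^ (-b) ≤ (2 * (1 + M)) ^ |b| * R ^ (-b) := by
    rcases le_total 0 b with hb | hb
    · rw [abs_of_nonneg hb, Real.rpow_neg hr.le, Real.rpow_neg hR.le]
      have := Real.rpow_le_rpow hR.le h1 hb
      rw [Real.mul_rpow hA.le hr.le] at this
      rw [inv_eq_one_div, div_le_iff₀ (by positivity)]
      have hRb : 0 < R ^ b := by positivity
      rw [mul_right_comm, ← div_eq_mul_inv, le_div_iff₀ hRb]
      linarith
    · rw [abs_of_nonpos hb, ← Real.mul_rpow hA.le hR.le]
      exact Real.rpow_le_rpow hr.le h2 (by linarith)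
  have : 0 < R ^ (-b) := by positivity
  nlinarith

theorem aux_log (a : ℝ) (ha : 0 ≤ a) (t r : ℝ) (ht : 4 ≤ t) (hr : Real.sqrt (t / 2) ≤ r) :
    Real.log r ^ (-a) ≤ 4 ^ a * Real.log t ^ (-a) := by
  have hlt : 0 < Real.log t := Real.log_pos (by linarith)
  have h0 : 0 < Real.sqrt (t / 2) := Real.sqrt_pos.mpr (by linarith)
  have h1 : Real.log t / 4 ≤ Real.log r := by
    have h2 : Real.log (Real.sqrt (t/2)) ≤ Real.log r := Real.log_le_log h0 hr
    rw [Real.log_sqrt (by linarith), Real.log_div (by linarith) (by norm_num)] at h2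
    have h3 : Real.log 4 ≤ Real.log t := Real.log_le_log (by norm_num) ht
    have h4 : Real.log 4 = 2 * Real.log 2 := by
      rw [show (4:ℝ) = 2 ^ 2 by norm_num, Real.log_pow]; norm_num
    linarith
  calc Real.log r ^ (-a) ≤ (Real.log t / 4) ^ (-a) :=
        Real.rpow_le_rpow_of_nonpos (by positivity) h1 (by linarith)
    _ = _ := by
        rw [Real.div_rpow hlt.le (by norm_num), Real.rpow_neg (by norm_num : (0:ℝ) ≤ 4)]
        rw [div_inv_eq_mul, mul_comm]

noncomputable def kker (n : ℕ) (a b t : ℝ) (x : EuclideanSpace ℝ (Fin n)) (s : ℝ)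
    (z : EuclideanSpace ℝ (Fin n)) : ℝ :=
  (4 * Real.pi * (t - s)) ^ (-(n : ℝ) / 2) * Real.exp (-‖x - z‖ ^ 2 / (4 * (t - s))) *
    (if Real.sqrt s ≤ ‖z‖ then ‖z‖ ^ (-b) * Real.log ‖z‖ ^ (-a) else 0)

theorem kker_nonneg (n : ℕ) (a b t : ℝ) (x : EuclideanSpace ℝ (Fin n)) (s : ℝ)
    (z : EuclideanSpace ℝ (Fin n)) (hs : 4 ≤ s) (hst : s ≤ t) : 0 ≤ kker n a b t x s z := by
  unfold kker
  have h1 : 0 ≤ t - s := by linarith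
  have := Real.pi_pos
  split_ifs with h
  · have h2 : 2 ≤ ‖z‖ := le_trans (Real.le_sqrt_of_sq_le (by linarith)) h
    have h3 : 0 ≤ Real.log ‖z‖ := Real.log_nonneg (by linarith)
    positivity
  · simp

theorem dom1 (n : ℕ) (a b : ℝ) (ha : 0 ≤ a) : ∃ C : ℝ, 0 < C ∧ ∀ t s : ℝ,
    ∀ x z : EuclideanSpace ℝ (Fin n), 4 ≤ s → s < t → Real.sqrt (t / 2) ≤ ‖z‖ →
    kker n a b t x s z ≤ C * ((max (Real.sqrt t) ‖x‖) ^ (-b) * Real.log t ^ (-a)) *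
      ((4 * Real.pi * (t - s)) ^ (-(n : ℝ) / 2) * Real.exp (-(1 / (8 * (t - s))) * ‖x - z‖ ^ 2)) := by
  obtain ⟨C, hC, h⟩ := aux_ratio b
  refine ⟨C * 4 ^ a, by positivity, fun t s x z hs hst hz => ?_⟩
  have ht : 4 ≤ t := by linarith
  have h1 : 0 < t - s := by linarith
  have hpi := Real.pi_pos
  have hlt : 0 < Real.log t := Real.log_pos (by linarith)
  have hz0 : 0 < ‖z‖ := lt_of_lt_of_le (Real.sqrt_pos.mpr (by linarith)) hz
  have hst0 : 0 < Real.sqrt t := Real.sqrt_pos.mpr (by linarith)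
  set R := max (Real.sqrt t) ‖x‖ with hR
  have hR0 : 0 < R := lt_of_lt_of_le hst0 (le_max_left _ _)
  have hP : 0 ≤ (4 * Real.pi * (t - s)) ^ (-(n : ℝ) / 2) := by positivity
  have hlog := aux_log a ha t ‖z‖ ht hz
  unfold kker
  split_ifs with hc
  swap
  · rw [mul_zero]; positivity
  have hz2 : 2 ≤ ‖z‖ := le_trans (Real.le_sqrt_of_sq_le (by linarith)) hc
  have hlz : 0 < Real.log ‖z‖ := Real.log_pos (by linarith)
  set M := ‖x - z‖ / Real.sqrt t with hM
  have hM0 : 0 ≤ M := by positivity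
  have hMt : ‖x - z‖ = M * Real.sqrt t := by rw [hM]; field_simp
  have hzt : Real.sqrt t ≤ 2 * ‖z‖ := by
    have : Real.sqrt t ≤ 2 * Real.sqrt (t / 2) := by
      rw [Real.sqrt_le_left (by positivity), mul_pow, Real.sq_sqrt (by linarith)]; linarith
    linarith
  have hxz : ‖x‖ ≤ ‖z‖ + ‖x - z‖ := by
    have := norm_add_le z (x - z); simpa using this
  have hzx : ‖z‖ ≤ ‖x‖ + ‖x - z‖ := by
    have := norm_sub_le x (x - z); simpa using this
  have hr1 : R ≤ 2 * (1 + M) * ‖z‖ := by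
    apply max_le
    · nlinarith
    · nlinarith
  have hr2 : ‖z‖ ≤ 2 * (1 + M) * R := by
    have e1 : ‖x‖ ≤ R := le_max_right _ _
    have e2 : Real.sqrt t ≤ R := le_max_left _ _
    nlinarith
  have key := h M R ‖z‖ hM0 hR0 hz0 hr1 hr2
  have hM2 : M ^ 2 / 8 ≤ ‖x - z‖ ^ 2 / (8 * (t - s)) := by
    rw [hM, div_pow, Real.sq_sqrt (by linarith), div_div, mul_comm t 8]
    apply div_le_div_of_nonneg_left (by positivity) (by positivity); linarith
  have hexp : Real.exp (-‖x - z‖ ^ 2 / (4 * (t - s))) * Real.exp (M ^ 2 / 8) ≤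
      Real.exp (-(1 / (8 * (t - s))) * ‖x - z‖ ^ 2) := by
    rw [← Real.exp_add]
    apply Real.exp_le_exp.mpr
    have : -‖x - z‖ ^ 2 / (4 * (t - s)) = - (‖x - z‖ ^ 2 / (8 * (t - s))) * 2 := by
      field_simp; ring
    have e : -(1 / (8 * (t - s))) * ‖x - z‖ ^ 2 = - (‖x - z‖ ^ 2 / (8 * (t - s))) := by
      field_simp
    rw [this, e]; linarith
  calc _ ≤ (4 * Real.pi * (t - s)) ^ (-(n : ℝ) / 2) * Real.exp (-‖x - z‖ ^ 2 / (4 * (t - s))) *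
          ((C * R ^ (-b) * Real.exp (M ^ 2 / 8)) * (4 ^ a * Real.log t ^ (-a))) := by
        gcongr
    _ = C * 4 ^ a * (R ^ (-b) * Real.log t ^ (-a)) * ((4 * Real.pi * (t - s)) ^ (-(n : ℝ) / 2) *
        (Real.exp (-‖x - z‖ ^ 2 / (4 * (t - s))) * Real.exp (M ^ 2 / 8))) := by ring
    _ ≤ _ := by gcongr

theorem dom2 (n : ℕ) (a b : ℝ) : ∃ C : ℝ, 0 < C ∧ ∀ t s : ℝ,
    ∀ x z : EuclideanSpace ℝ (Fin n), 4 ≤ s → s ≤ t / 2 → ‖z‖ ≤ Real.sqrt t → 2 ≤ ‖z‖ → 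
    kker n a b t x s z ≤ C * (t ^ (-(n : ℝ) / 2) * Real.exp (-‖x‖ ^ 2 / (8 * t))) *
      (‖z‖ ^ (-b) * Real.log ‖z‖ ^ (-a)) := by
  refine ⟨(2 * Real.pi) ^ (-(n : ℝ) / 2) * Real.exp (1 / 4), by positivity,
    fun t s x z hs hst hz hz2 => ?_⟩
  have hpi := Real.pi_pos
  have ht : 0 < t := by linarith
  have h1 : 0 < t - s := by linarith
  have hlz : 0 < Real.log ‖z‖ := Real.log_pos (by linarith)
  unfold kker
  have hz0 : 0 < ‖z‖ := by linarith
  have e1 : (4 * Real.pi * (t - s)) ^ (-(n : ℝ) / 2) ≤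
      (2 * Real.pi) ^ (-(n : ℝ) / 2) * t ^ (-(n : ℝ) / 2) := by
    rw [← Real.mul_rpow (by positivity) ht.le]
    apply Real.rpow_le_rpow_of_nonpos (by positivity)
    · nlinarith
    · have : (0:ℝ) ≤ n := by positivity
      linarith
  have hzz : ‖z‖ ^ 2 ≤ t := by
    have := pow_le_pow_left₀ (norm_nonneg z) hz 2
    rwa [Real.sq_sqrt ht.le] at this
  have hxz : ‖x‖ ≤ ‖z‖ + ‖x - z‖ := by
    have := norm_add_le z (x - z); simpa using this
  have e2 : Real.exp (-‖x - z‖ ^ 2 / (4 * (t - s))) ≤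
      Real.exp (1 / 4) * Real.exp (-‖x‖ ^ 2 / (8 * t)) := by
    rw [← Real.exp_add]
    apply Real.exp_le_exp.mpr
    have f1 : -‖x - z‖ ^ 2 / (4 * (t - s)) ≤ -‖x - z‖ ^ 2 / (4 * t) := by
      rw [neg_div, neg_div, neg_le_neg_iff]
      apply div_le_div_of_nonneg_left (by positivity) (by positivity); linarith
    refine f1.trans ?_
    have f2 : 1 / 4 + -‖x‖ ^ 2 / (8 * t) - -‖x - z‖ ^ 2 / (4 * t) =
      (2 * t - ‖x‖ ^ 2 + 2 * ‖x - z‖ ^ 2) / (8 * t) := by field_simp; ring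
    have f3 : 0 ≤ (2 * t - ‖x‖ ^ 2 + 2 * ‖x - z‖ ^ 2) / (8 * t) := by
      apply div_nonneg _ (by positivity)
      have := pow_le_pow_left₀ (norm_nonneg x) hxz 2
      nlinarith [sq_nonneg (‖z‖ - ‖x - z‖)]
    linarith
  have hW : 0 ≤ ‖z‖ ^ (-b) * Real.log ‖z‖ ^ (-a) := by positivity
  calc _ ≤ (4 * Real.pi * (t - s)) ^ (-(n : ℝ) / 2) * Real.exp (-‖x - z‖ ^ 2 / (4 * (t - s))) *
        (‖z‖ ^ (-b) * Real.log ‖z‖ ^ (-a)) := by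
        gcongr; split_ifs
        · exact le_rfl
        · exact hW
    _ ≤ ((2 * Real.pi) ^ (-(n : ℝ) / 2) * t ^ (-(n : ℝ) / 2)) *
        (Real.exp (1 / 4) * Real.exp (-‖x‖ ^ 2 / (8 * t))) *
        (‖z‖ ^ (-b) * Real.log ‖z‖ ^ (-a)) := by gcongr
    _ = _ := by ring

theorem radial_int (n : ℕ) (hn : 3 ≤ n) (T : ℝ) (hT : 2 ≤ T) (h F : ℝ → ℝ)
    (hc : ContinuousOn h (Set.Icc 2 T)) (hF : ∀ r ∈ Set.Icc 2 T, HasDerivAt F (r ^ (n - 1) * h r) r)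
    (hF2 : 0 ≤ F 2) :
    Integrable (fun z : EuclideanSpace ℝ (Fin n) => (Set.Icc 2 T).indicator h ‖z‖) ∧
    ∫ z : EuclideanSpace ℝ (Fin n), (Set.Icc 2 T).indicator h ‖z‖ ≤
      n * (volume : Measure (EuclideanSpace ℝ (Fin n))).real (Metric.ball 0 1) * F T := by
  have : Nonempty (Fin n) := ⟨⟨0, by omega⟩⟩
  have : Nontrivial (EuclideanSpace ℝ (Fin n)) := inferInstance
  have hcc : ContinuousOn (fun r : ℝ => r ^ (n - 1) * h r) (Set.Icc 2 T) := by fun_prop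
  have hsub : Set.Icc 2 T ⊆ Set.Ioi (0:ℝ) := fun r hr => by
    have := hr.1; simp only [Set.mem_Ioi]; linarith
  have e : (fun y : ℝ => y ^ (n - 1) • (Set.Icc 2 T).indicator h y) =
      (Set.Icc 2 T).indicator (fun r : ℝ => r ^ (n - 1) * h r) := by
    funext y
    by_cases hy : y ∈ Set.Icc 2 T
    · simp only [Set.indicator_of_mem hy, smul_eq_mul]
    · simp only [Set.indicator_of_notMem hy, smul_zero]
  constructor
  · rw [integrable_fun_norm_addHaar volume (f := (Set.Icc 2 T).indicator h)]
    rw [finrank_euclideanSpace_fin, e]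
    apply Integrable.integrableOn
    rw [integrable_indicator_iff measurableSet_Icc]
    exact hcc.integrableOn_Icc
  · rw [integral_fun_norm_addHaar volume ((Set.Icc 2 T).indicator h)]
    rw [finrank_euclideanSpace_fin, e, setIntegral_indicator measurableSet_Icc,
      Set.inter_eq_self_of_subset_right hsub, integral_Icc_eq_integral_Ioc,
      ← intervalIntegral.integral_of_le hT,
      intervalIntegral.integral_eq_sub_of_hasDerivAt (f := F)]
    · rw [nsmul_eq_mul, smul_eq_mul, mul_assoc]
      gcongr
      linarith
    · rwa [Set.uIcc_of_le hT]
    · exact ContinuousOn.intervalIntegrable (by rwa [Set.uIcc_of_le hT])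

theorem aux_log2 (δ : ℝ) (hδ : 0 < δ) (a : ℝ) (ha : a ∈ Set.Ico (0:ℝ) 1) :
    ∃ C : ℝ, 0 < C ∧ ∀ T r : ℝ, 2 ≤ r → r ≤ T →
    Real.log r ^ (-a) ≤ C * Real.log T ^ (-a) * (T / r) ^ δ := by
  have hl2 : 0 < Real.log 2 := Real.log_pos (by norm_num)
  refine ⟨1 + 1 / (δ * Real.log 2), by positivity, fun T r hr hrT => ?_⟩
  have hr0 : 0 < r := by linarith
  have hT0 : 0 < T := by linarith
  have hlr : 0 < Real.log r := Real.log_pos (by linarith)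
  have hlT : 0 < Real.log T := Real.log_pos (by linarith)
  have hl2r : Real.log 2 ≤ Real.log r := Real.log_le_log (by norm_num) hr
  have hlrT : Real.log r ≤ Real.log T := Real.log_le_log hr0 hrT
  have hq : 1 ≤ T / r := by rw [le_div_iff₀ hr0]; linarith
  have h1 : Real.log (T / r) ≤ (T / r) ^ δ / δ := Real.log_le_rpow_div (by positivity) hδ
  have h1' : 0 ≤ Real.log (T / r) := Real.log_nonneg hq
  have h2 : 1 ≤ (T / r) ^ δ := Real.one_le_rpow hq hδ.le
  have h3 : Real.log T / Real.log r ≤ (1 + 1 / (δ * Real.log 2)) * (T / r) ^ δ := by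
    have : Real.log T = Real.log r + Real.log (T / r) := by
      rw [Real.log_div hT0.ne' hr0.ne']; ring
    rw [this, add_div, div_self hlr.ne', add_mul, one_mul]
    have h4 : Real.log (T / r) / Real.log r ≤ ((T / r) ^ δ / δ) / Real.log 2 := by gcongr
    have h5 : ((T / r) ^ δ / δ) / Real.log 2 = 1 / (δ * Real.log 2) * (T / r) ^ δ := by
      field_simp
    linarith
  have h6 : (Real.log T / Real.log r) ^ a ≤ Real.log T / Real.log r := by
    have := Real.rpow_le_rpow_of_exponent_le
      (show 1 ≤ Real.log T / Real.log r by rw [le_div_iff₀ hlr]; linarith) ha.2.le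
    simpa using this
  have h7 : Real.log r ^ (-a) = Real.log T ^ (-a) * (Real.log T / Real.log r) ^ a := by
    rw [Real.div_rpow hlT.le hlr.le, Real.rpow_neg hlT.le, Real.rpow_neg hlr.le]
    field_simp
  rw [h7]
  have : 0 < Real.log T ^ (-a) := by positivity
  nlinarith [h6.trans h3]

noncomputable def DD (n : ℕ) (a b t : ℝ) : ℝ :=
  if b < n then t ^ (((n : ℝ) - b) / 2) * Real.log t ^ (-a) else Real.log t ^ (1 - a)

theorem inner_dom (n : ℕ) (hn : 3 ≤ n) (a b : ℝ)
    (ha : a ∈ Set.Ico (0:ℝ) 1) (hb : b ≤ n) : ∃ C : ℝ, 0 < C ∧ ∀ t : ℝ, 4 ≤ t → ∃ H : ℝ → ℝ,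
    (∀ r, 0 ≤ H r) ∧ (∀ r, 2 ≤ r → r ≤ Real.sqrt t → r ^ (-b) * Real.log r ^ (-a) ≤ H r) ∧
    Integrable (fun z : EuclideanSpace ℝ (Fin n) => H ‖z‖) ∧
    ∫ z : EuclideanSpace ℝ (Fin n), H ‖z‖ ≤ C * DD n a b t := by
  set ω := (n : ℝ) * (volume : Measure (EuclideanSpace ℝ (Fin n))).real (Metric.ball 0 1) with hω
  have hω0 : 0 ≤ ω := by positivity
  have ha1 : 0 < 1 - a := by linarith [ha.2]
  rcases hb.lt_or_eq with hb | hb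
  · set δ := ((n : ℝ) - b) / 2 with hδ
    have hδ0 : 0 < δ := by rw [hδ]; linarith
    obtain ⟨C, hC, h⟩ := aux_log2 δ hδ0 a ha
    refine ⟨ω * (C * 2 ^ a / δ) + 1, by positivity, fun t ht => ?_⟩
    have hT : 2 ≤ Real.sqrt t := Real.le_sqrt_of_sq_le (by linarith)
    set T := Real.sqrt t with hTd
    have hlT : 0 < Real.log T := Real.log_pos (by linarith)
    have hlt : 0 < Real.log t := Real.log_pos (by linarith)
    have hT0 : 0 < T := by linarith
    set c := C * Real.log T ^ (-a) * T ^ δ with hc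
    have hc0 : 0 < c := by positivity
    obtain ⟨hi, hle⟩ := radial_int n hn T hT (fun r => c * r ^ (-b - δ)) (fun r => c * (r ^ δ / δ))
      (by
        apply ContinuousOn.mul continuousOn_const
        apply ContinuousOn.rpow_const continuousOn_id
        intro r hr; left; have := hr.1; simp only [id]; linarith)
      (by
        intro r hr
        have hr0 : 0 < r := by linarith [hr.1]
        have := ((Real.hasDerivAt_rpow_const (x := r) (p := δ) (Or.inl hr0.ne')).div_const δ).const_mul c
        refine this.congr_deriv (Eq.symm ?_)
        rw [mul_div_cancel_left₀ _ hδ0.ne', mul_left_comm, ← Real.rpow_natCast, ← Real.rpow_add hr0,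
          Nat.cast_sub (by omega)]
        congr 2
        rw [hδ]; push_cast; ring)
      (by positivity)
    refine ⟨_, ?_, ?_, hi, hle.trans ?_⟩
    · intro r
      apply Set.indicator_nonneg
      intro r hr
      have hr0 : 0 < r := by linarith [hr.1]
      positivity
    · intro r hr hrT
      rw [Set.indicator_of_mem (show r ∈ Set.Icc 2 T from ⟨hr, hrT⟩)]
      have hr0 : 0 < r := by linarith
      calc _ ≤ r ^ (-b) * (C * Real.log T ^ (-a) * (T / r) ^ δ) := by
            gcongr; exact h T r hr hrT
        _ = _ := by
            rw [Real.div_rpow hT0.le hr0.le, Real.rpow_sub hr0, hc]; ring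
    · unfold DD
      rw [if_pos hb, ← hω]
      have e1 : T ^ δ * T ^ δ = t ^ δ := by
        rw [← Real.mul_rpow hT0.le hT0.le, Real.mul_self_sqrt (by linarith)]
      have e2 : Real.log T ^ (-a) = 2 ^ a * Real.log t ^ (-a) := by
        rw [hTd, Real.log_sqrt (by linarith), Real.div_rpow hlt.le (by norm_num),
          Real.rpow_neg (by norm_num : (0:ℝ) ≤ 2), div_inv_eq_mul, mul_comm]
      have e3 : ω * (c * (T ^ δ / δ)) = ω * (C * 2 ^ a / δ) * (t ^ δ * Real.log t ^ (-a)) := by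
        rw [hc, e2, ← e1]; ring
      rw [e3]
      have : 0 ≤ t ^ δ * Real.log t ^ (-a) := by positivity
      linarith
  · refine ⟨ω * (1 / (1 - a)) + 1, by positivity, fun t ht => ?_⟩
    have hT : 2 ≤ Real.sqrt t := Real.le_sqrt_of_sq_le (by linarith)
    set T := Real.sqrt t with hTd
    have hlT : 0 < Real.log T := Real.log_pos (by linarith)
    have hlt : 0 < Real.log t := Real.log_pos (by linarith)
    have hT0 : 0 < T := by linarith
    have hl2 : 0 < Real.log 2 := Real.log_pos (by norm_num)
    obtain ⟨hi, hle⟩ := radial_int n hn T hT (fun r => r ^ (-b) * Real.log r ^ (-a))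
      (fun r => Real.log r ^ (1 - a) / (1 - a))
      (by
        apply ContinuousOn.mul
        · apply ContinuousOn.rpow_const continuousOn_id
          intro r hr; left; have := hr.1; simp only [id]; linarith
        · apply ContinuousOn.rpow_const
          · apply ContinuousOn.log continuousOn_id
            intro r hr; have := hr.1; simp only [id]; linarith
          · intro r hr; left; exact (Real.log_pos (by linarith [hr.1])).ne')
      (by
        intro r hr
        have hr0 : 0 < r := by linarith [hr.1]
        have hlr : 0 < Real.log r := Real.log_pos (by linarith [hr.1])
        have := ((Real.hasDerivAt_log hr0.ne').rpow_const (p := 1 - a) (Or.inl hlr.ne')).div_const (1 - a)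
        refine this.congr_deriv (Eq.symm ?_)
        have e0 : r ^ (n - 1) * r ^ (-b) = r⁻¹ := by
          rw [← Real.rpow_natCast, ← Real.rpow_add hr0, Nat.cast_sub (by omega), hb,
            ← Real.rpow_neg_one]
          congr 1; push_cast; ring
        rw [← mul_assoc, e0, show 1 - a - 1 = -a by ring]
        field_simp)
      (by positivity)
    refine ⟨_, ?_, ?_, hi, hle.trans ?_⟩
    · intro r
      apply Set.indicator_nonneg
      intro r hr
      have hr0 : 0 < r := by linarith [hr.1]
      have hlr : 0 < Real.log r := Real.log_pos (by linarith [hr.1])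
      positivity
    · intro r hr hrT
      rw [Set.indicator_of_mem (show r ∈ Set.Icc 2 T from ⟨hr, hrT⟩)]
    · unfold DD
      rw [if_neg (by linarith), ← hω]
      have e1 : Real.log T ^ (1 - a) ≤ Real.log t ^ (1 - a) := by
        apply Real.rpow_le_rpow hlT.le _ ha1.le
        rw [hTd, Real.log_sqrt (by linarith)]; linarith
      have e2 : 0 ≤ Real.log t ^ (1 - a) := by positivity
      calc ω * (Real.log T ^ (1 - a) / (1 - a)) ≤ ω * (Real.log t ^ (1 - a) / (1 - a)) := by gcongr
        _ = ω * (1 / (1 - a)) * Real.log t ^ (1 - a) := by ring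
        _ ≤ _ := by linarith

theorem gauss_int (n : ℕ) (τ : ℝ) (hτ : 0 < τ) (x : EuclideanSpace ℝ (Fin n)) :
    Integrable (fun z : EuclideanSpace ℝ (Fin n) =>
      (4 * Real.pi * τ) ^ (-(n : ℝ) / 2) * Real.exp (-(1 / (8 * τ)) * ‖x - z‖ ^ 2)) ∧
    ∫ z : EuclideanSpace ℝ (Fin n),
      (4 * Real.pi * τ) ^ (-(n : ℝ) / 2) * Real.exp (-(1 / (8 * τ)) * ‖x - z‖ ^ 2)
      = 2 ^ ((n : ℝ) / 2) := by
  have hpi := Real.pi_pos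
  have h8 : 0 < 1 / (8 * τ) := by positivity
  have hi := GaussianFourier.integral_rexp_neg_mul_sq_norm (V := EuclideanSpace ℝ (Fin n)) h8
  have hpos : 0 < (Real.pi / (1 / (8 * τ))) ^ ((n : ℝ) / 2) := by positivity
  rw [finrank_euclideanSpace_fin] at hi
  have hI : Integrable (fun z : EuclideanSpace ℝ (Fin n) => Real.exp (-(1 / (8 * τ)) * ‖z‖ ^ 2)) := by
    by_contra hcon
    rw [integral_undef hcon] at hi
    linarith
  constructor
  · apply Integrable.const_mul
    exact hI.comp_sub_left x
  · rw [integral_const_mul, integral_sub_left_eq_self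
      (fun z : EuclideanSpace ℝ (Fin n) => Real.exp (-(1 / (8 * τ)) * ‖z‖ ^ 2)) volume x, hi,
      neg_div, Real.rpow_neg (by positivity), show Real.pi / (1 / (8 * τ)) = 2 * (4 * Real.pi * τ) by
        field_simp; ring, Real.mul_rpow (x := 2) (y := 4 * Real.pi * τ) (by norm_num) (by positivity)]
    have : 0 < (4 * Real.pi * τ) ^ ((n : ℝ) / 2) := by positivity
    rw [mul_left_comm, inv_mul_cancel₀ this.ne', mul_one]

theorem kker_meas (n : ℕ) (a b t : ℝ) (x : EuclideanSpace ℝ (Fin n)) :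
    Measurable (fun p : ℝ × EuclideanSpace ℝ (Fin n) => kker n a b t x p.1 p.2) := by
  unfold kker
  apply Measurable.mul
  · fun_prop
  · apply Measurable.ite
    · exact measurableSet_le (by fun_prop) (by fun_prop)
    · fun_prop
    · fun_prop

/-- the bounds for the spatial integral -/
theorem g_bound (n : ℕ) (hn : 3 ≤ n) (a b : ℝ)
    (ha : a ∈ Set.Ico (0:ℝ) 1) (hb : b ≤ n) : ∃ C : ℝ, 0 < C ∧ ∀ t s : ℝ,
    ∀ x : EuclideanSpace ℝ (Fin n), 4 ≤ s → 
    (t / 2 ≤ s → s < t → ∫ z, kker n a b t x s z ≤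
      C * ((max (Real.sqrt t) ‖x‖) ^ (-b) * Real.log t ^ (-a))) ∧
    (s ≤ t / 2 → Integrable (kker n a b t x s) ∧ ∫ z, kker n a b t x s z ≤
      C * ((max (Real.sqrt t) ‖x‖) ^ (-b) * Real.log t ^ (-a) +
        t ^ (-(n : ℝ) / 2) * Real.exp (-‖x‖ ^ 2 / (8 * t)) * DD n a b t)) := by
  obtain ⟨C1, hC1, h1⟩ := dom1 n a b ha.1
  obtain ⟨C2, hC2, h2⟩ := dom2 n a b
  obtain ⟨C3, hC3, h3⟩ := inner_dom n hn a b ha hb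
  have hp2 : (0:ℝ) < 2 ^ ((n : ℝ) / 2) := by positivity
  refine ⟨C1 * 2 ^ ((n : ℝ) / 2) + C2 * C3, by positivity, fun t s x hs => ⟨fun hts hst => ?_,
    fun hst => ?_⟩⟩
  · obtain ⟨gi, ge⟩ := gauss_int n (t - s) (by linarith) x
    have hlt : 0 < Real.log t := Real.log_pos (by linarith)
    set A := (max (Real.sqrt t) ‖x‖) ^ (-b) * Real.log t ^ (-a) with hA
    have hA0 : 0 ≤ A := by positivity
    calc _ ≤ ∫ z, C1 * A * ((4 * Real.pi * (t - s)) ^ (-(n : ℝ) / 2) *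
            Real.exp (-(1 / (8 * (t - s))) * ‖x - z‖ ^ 2)) := by
          apply integral_mono_of_nonneg
          · exact Filter.Eventually.of_forall fun z => kker_nonneg n a b t x s z hs hst.le
          · exact gi.const_mul _
          · refine Filter.Eventually.of_forall fun z => ?_
            by_cases hz : Real.sqrt (t / 2) ≤ ‖z‖
            · exact h1 t s x z hs hst hz
            · have : ¬ (Real.sqrt s ≤ ‖z‖) := fun h => hz ((Real.sqrt_le_sqrt hts).trans h)
              simp only [kker, if_neg this, mul_zero]
              have := Real.pi_pos
              have : 0 < t - s := by linarith
              positivity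
      _ = C1 * A * 2 ^ ((n : ℝ) / 2) := by rw [integral_const_mul, ge]
      _ ≤ _ := by nlinarith [mul_nonneg (mul_pos hC2 hC3).le hA0]
  · have ht : 8 ≤ t := by linarith
    have hst' : s < t := by linarith
    obtain ⟨gi, ge⟩ := gauss_int n (t - s) (by linarith) x
    obtain ⟨H, H0, H1, H2, H3⟩ := h3 t (by linarith)
    have hlt : 0 < Real.log t := Real.log_pos (by linarith)
    set A := (max (Real.sqrt t) ‖x‖) ^ (-b) * Real.log t ^ (-a) with hA
    set B := t ^ (-(n : ℝ) / 2) * Real.exp (-‖x‖ ^ 2 / (8 * t)) with hB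
    have hA0 : 0 ≤ A := by positivity
    have hB0 : 0 ≤ B := by positivity
    have hD0 : 0 ≤ DD n a b t := by
      unfold DD; split_ifs <;> positivity
    have hdi := (gi.const_mul (C1 * A)).add (H2.const_mul (C2 * B))
    have hpt : ∀ z, kker n a b t x s z ≤ C1 * A * ((4 * Real.pi * (t - s)) ^ (-(n : ℝ) / 2) *
            Real.exp (-(1 / (8 * (t - s))) * ‖x - z‖ ^ 2)) + C2 * B * H ‖z‖ := by
      intro z
      have p1 : 0 ≤ C1 * A * ((4 * Real.pi * (t - s)) ^ (-(n : ℝ) / 2) *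
            Real.exp (-(1 / (8 * (t - s))) * ‖x - z‖ ^ 2)) := by
        have := Real.pi_pos
        have : 0 < t - s := by linarith
        positivity
      have p2 : 0 ≤ C2 * B * H ‖z‖ := mul_nonneg (by positivity) (H0 _)
      by_cases hz : Real.sqrt (t / 2) ≤ ‖z‖
      · have := h1 t s x z hs hst' hz
        linarith
      · by_cases hz2 : Real.sqrt s ≤ ‖z‖
        · have hz3 : 2 ≤ ‖z‖ := le_trans (Real.le_sqrt_of_sq_le (by linarith)) hz2
          have hz4 : ‖z‖ ≤ Real.sqrt t := by
            have := Real.sqrt_le_sqrt (show t / 2 ≤ t by linarith)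
            linarith
          have q1 := h2 t s x z hs hst hz4 hz3
          have q2 := mul_le_mul_of_nonneg_left (H1 ‖z‖ hz3 hz4) (show 0 ≤ C2 * B by positivity)
          linarith
        · simp only [kker, if_neg hz2, mul_zero]
          linarith
    constructor
    · refine Integrable.mono' hdi ?_ ?_
      · exact ((kker_meas n a b t x).comp (measurable_const.prodMk measurable_id)).aestronglyMeasurable
      · refine Filter.Eventually.of_forall fun z => ?_
        rw [Real.norm_of_nonneg (kker_nonneg n a b t x s z hs hst'.le)]
        exact hpt z
    · calc _ ≤ ∫ z, (C1 * A * ((4 * Real.pi * (t - s)) ^ (-(n : ℝ) / 2) *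
            Real.exp (-(1 / (8 * (t - s))) * ‖x - z‖ ^ 2)) + C2 * B * H ‖z‖) := by
            apply integral_mono_of_nonneg
            · exact Filter.Eventually.of_forall fun z => kker_nonneg n a b t x s z hs hst'.le
            · exact hdi
            · exact Filter.Eventually.of_forall hpt
        _ = C1 * A * 2 ^ ((n : ℝ) / 2) + C2 * B * ∫ z : EuclideanSpace ℝ (Fin n), H ‖z‖ := by
            rw [integral_add (gi.const_mul (C1 * A)) (H2.const_mul (C2 * B)), integral_const_mul, ge,
              integral_const_mul]
        _ ≤ C1 * A * 2 ^ ((n : ℝ) / 2) + C2 * B * (C3 * DD n a b t) := by gcongr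
        _ ≤ _ := by
            nlinarith [mul_nonneg (mul_pos hC2 hC3).le hA0, mul_nonneg (mul_pos hC1 hp2).le
              (mul_nonneg hB0 hD0)]

/-- lower bound for the spatial integral -/
theorem g_lower (n : ℕ) (hn : 3 ≤ n) (a b : ℝ)
    (ha : a ∈ Set.Ico (0:ℝ) 1) (hb : b ≤ n) (t : ℝ) (x : EuclideanSpace ℝ (Fin n)) (ht : 8 ≤ t) :
    ∃ c : ℝ, 0 < c ∧ ∀ s, 4 ≤ s → s ≤ t / 2 → c ≤ ∫ z, kker n a b t x s z := by
  obtain ⟨C, hC, hg⟩ := g_bound n hn a b ha hb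
  have : Nonempty (Fin n) := ⟨⟨0, by omega⟩⟩
  have : Nontrivial (EuclideanSpace ℝ (Fin n)) := inferInstance
  have hpi := Real.pi_pos
  have hpos : 0 < ∫ z, kker n a b t x (t / 2) z := by
    rw [integral_pos_iff_support_of_nonneg
      (fun z => kker_nonneg n a b t x (t/2) z (by linarith) (by linarith))
      ((hg t (t/2) x (by linarith)).2 le_rfl).1]
    have hopen : IsOpen {z : EuclideanSpace ℝ (Fin n) | Real.sqrt (t / 2) < ‖z‖} :=
      isOpen_lt continuous_const continuous_norm
    have hne : {z : EuclideanSpace ℝ (Fin n) | Real.sqrt (t / 2) < ‖z‖}.Nonempty :=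
      NormedSpace.exists_lt_norm ℝ (EuclideanSpace ℝ (Fin n)) _
    refine lt_of_lt_of_le (hopen.measure_pos volume hne) (measure_mono ?_)
    intro z hz
    have hz' : Real.sqrt (t / 2) < ‖z‖ := hz
    have hz2 : 2 ≤ ‖z‖ := le_trans (Real.le_sqrt_of_sq_le (by linarith)) hz'.le
    have hlz : 0 < Real.log ‖z‖ := Real.log_pos (by linarith)
    have : 0 < ‖z‖ := by linarith
    have : 0 < t - t / 2 := by linarith
    rw [Function.mem_support, kker, if_pos hz'.le]
    positivity
  refine ⟨2 ^ (-(n : ℝ) / 2) * ∫ z, kker n a b t x (t / 2) z, by positivity, fun s hs hst => ?_⟩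
  rw [← integral_const_mul]
  apply integral_mono (((hg t (t/2) x (by linarith)).2 le_rfl).1.const_mul _)
    ((hg t s x hs).2 hst).1
  intro z
  simp only
  by_cases hz : Real.sqrt (t / 2) ≤ ‖z‖
  · have hz' : Real.sqrt s ≤ ‖z‖ := (Real.sqrt_le_sqrt hst).trans hz
    have hz2 : 2 ≤ ‖z‖ := le_trans (Real.le_sqrt_of_sq_le (by linarith)) hz
    have hlz : 0 < Real.log ‖z‖ := Real.log_pos (by linarith)
    rw [kker, kker, if_pos hz, if_pos hz', ← mul_assoc _ (_ * _) (_ * _), ← mul_assoc (2 ^ (-(n : ℝ) / 2)),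
      ← Real.mul_rpow (by norm_num) (by nlinarith)]
    have h0 : 0 < t - s := by linarith
    have e1 : (2 * (4 * Real.pi * (t - t / 2))) ^ (-(n : ℝ) / 2) ≤
        (4 * Real.pi * (t - s)) ^ (-(n : ℝ) / 2) := by
      apply Real.rpow_le_rpow_of_nonpos (by positivity)
      · nlinarith
      · have : (0:ℝ) ≤ n := by positivity
        linarith
    have e2 : Real.exp (-‖x - z‖ ^ 2 / (4 * (t - t / 2))) ≤
        Real.exp (-‖x - z‖ ^ 2 / (4 * (t - s))) := by
      apply Real.exp_le_exp.mpr
      rw [neg_div, neg_div, neg_le_neg_iff]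
      apply div_le_div_of_nonneg_left (by positivity) (by linarith); linarith
    gcongr
  · rw [kker, if_neg hz, mul_zero, mul_zero]
    exact kker_nonneg n a b t x s z hs (by linarith)

theorem time_bound (t0 t V A1 A2 c : ℝ) (v g : ℝ → ℝ) (ht0 : 4 ≤ t0) (htt : t0 ≤ t)
    (hv : ∀ s, 0 ≤ v s) (hv0 : ∀ s, s < t0 → v s = 0) (hV : ∀ s ∈ Set.Icc (t / 2) t, v s ≤ V)
    (hA1 : 0 ≤ A1) (hA2 : 0 ≤ A2) (hgm : StronglyMeasurable g)
    (hg0 : ∀ s, 4 ≤ s → s ≤ t → 0 ≤ g s)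
    (hg1 : ∀ s, 4 ≤ s → t / 2 ≤ s → s < t → g s ≤ A1)
    (hg2 : ∀ s, 4 ≤ s → s ≤ t / 2 → g s ≤ A1 + A2)
    (hc : 0 < c) (hgc : ∀ s, 4 ≤ s → s ≤ t / 2 → c ≤ g s) :
    ∫ s in t0..t, v s * g s ≤ A1 * (t * V + ∫ s in (t0 / 2)..(t / 2), v s) +
      A2 * ∫ s in (t0 / 2)..(t / 2), v s := by
  have hI0 : 0 ≤ ∫ s in (t0 / 2)..(t / 2), v s :=
    intervalIntegral.integral_nonneg (by linarith) fun s _ => hv s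
  have hV0 : 0 ≤ V := (hv t).trans (hV t ⟨by linarith, le_rfl⟩)
  have ht : 0 < t := by linarith
  by_cases hint : IntervalIntegrable (fun s => v s * g s) volume t0 t
  swap
  · rw [intervalIntegral.integral_undef hint]
    positivity
  have late : ∀ r, t0 ≤ r → t / 2 ≤ r → r ≤ t →
      IntervalIntegrable (fun s => v s * g s) volume r t →
      ∫ s in r..t, v s * g s ≤ A1 * (t * V) := by
    intro r hr1 hr2 hr3 hri
    calc _ ≤ ∫ s in r..t, V * A1 := by
          apply intervalIntegral.integral_mono_on_of_le_Ioo hr3 hri intervalIntegrable_const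
          intro s hs
          have h1 := hV s ⟨by linarith [hs.1], hs.2.le⟩
          have h2 := hg1 s (by linarith [hs.1]) (by linarith [hs.1]) hs.2
          have h3 := hg0 s (by linarith [hs.1]) hs.2.le
          exact mul_le_mul h1 h2 h3 hV0
      _ = (t - r) * (V * A1) := by rw [intervalIntegral.integral_const, smul_eq_mul]
      _ ≤ t * (V * A1) := by
          gcongr; linarith
      _ = _ := by ring
  rcases le_total (t / 2) t0 with h | h
  · have := late t0 le_rfl h htt hint
    nlinarith [mul_nonneg hA1 hI0, mul_nonneg hA2 hI0]
  have hi1 : IntervalIntegrable (fun s => v s * g s) volume t0 (t / 2) := by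
    apply hint.mono_set
    rw [Set.uIcc_of_le h, Set.uIcc_of_le htt]
    exact Set.Icc_subset_Icc le_rfl (by linarith)
  have hi2 : IntervalIntegrable (fun s => v s * g s) volume (t / 2) t := by
    apply hint.mono_set
    rw [Set.uIcc_of_le (by linarith), Set.uIcc_of_le htt]
    exact Set.Icc_subset_Icc h le_rfl
  have hvi : IntervalIntegrable v volume t0 (t / 2) := by
    rw [intervalIntegrable_iff_integrableOn_Ioc_of_le h] at hi1 ⊢
    have hm : AEStronglyMeasurable (fun s => (g s)⁻¹) (volume.restrict (Set.Ioc t0 (t / 2))) :=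
      hgm.measurable.inv.aestronglyMeasurable
    have := Integrable.mul_bdd (c := c⁻¹) hi1 hm (by
      rw [ae_restrict_iff' measurableSet_Ioc]
      refine Filter.Eventually.of_forall fun s hs => ?_
      have := hgc s (by linarith [hs.1]) hs.2
      rw [Real.norm_of_nonneg (inv_nonneg.mpr (by linarith))]
      exact inv_anti₀ hc this)
    refine IntegrableOn.congr_fun this ?_ measurableSet_Ioc
    intro s hs
    have := hgc s (by linarith [hs.1]) hs.2
    have h0 : g s ≠ 0 := by linarith
    simp only
    field_simp
  have hz : ∀ᵐ s, s ∈ Set.uIoc (t0 / 2) t0 → v s = 0 := by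
    have : ∀ᵐ s : ℝ, s ≠ t0 := by simp [ae_iff]
    filter_upwards [this] with s hs hs'
    rw [Set.uIoc_of_le (by linarith)] at hs'
    exact hv0 s (lt_of_le_of_ne hs'.2 hs)
  have hvi0 : IntervalIntegrable v volume (t0 / 2) t0 := by
    apply (intervalIntegrable_const (c := (0:ℝ))).congr_ae
    rw [Filter.EventuallyEq, ae_restrict_iff' measurableSet_uIoc]
    filter_upwards [hz] with s hs hs'
    exact (hs hs').symm
  have hsplit : ∫ s in (t0 / 2)..(t / 2), v s = ∫ s in t0..(t / 2), v s := by
    rw [← intervalIntegral.integral_add_adjacent_intervals hvi0 hvi,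
      intervalIntegral.integral_zero_ae hz, zero_add]
  have h1 : ∫ s in t0..(t / 2), v s * g s ≤ (A1 + A2) * ∫ s in t0..(t / 2), v s := by
    rw [← intervalIntegral.integral_const_mul]
    apply intervalIntegral.integral_mono_on h hi1 (hvi.const_mul _)
    intro s hs
    rw [mul_comm]
    exact mul_le_mul_of_nonneg_right (hg2 s (by linarith [hs.1]) hs.2) (hv s)
  rw [← intervalIntegral.integral_add_adjacent_intervals hi1 hi2, hsplit]
  have h2 := late (t / 2) h le_rfl (by linarith) hi2
  nlinarith

theorem Tout_bound (n : ℕ) (hn : 3 ≤ n) (a b : ℝ)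
    (ha : a ∈ Set.Ico (0:ℝ) 1) (hb : b ≤ n) :
    ∃ C : ℝ, 0 < C ∧ ∀ t0 : ℝ, 4 ≤ t0 →
      ∀ v : ℝ → ℝ, (∀ s, 0 ≤ v s) → (∀ s, s < t0 → v s = 0) →
      ∀ t : ℝ, t0 ≤ t → ∀ x : EuclideanSpace ℝ (Fin n),
      ∀ V : ℝ, (∀ s ∈ Set.Icc (t / 2) t, v s ≤ V) →
        Tout n t0 (fun z s => if Real.sqrt s ≤ ‖z‖
              then v s * ‖z‖ ^ (-b) * Real.log ‖z‖ ^ (-a) else 0) x t ≤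
        C * (((max (Real.sqrt t) ‖x‖) ^ (-b) * Real.log t ^ (-a)) *
            (t * V + ∫ s in (t0 / 2)..(t / 2), v s) +
          t ^ (-(n : ℝ) / 2) * Real.exp (-‖x‖ ^ 2 / (8 * t)) * DD n a b t *
            ∫ s in (t0 / 2)..(t / 2), v s) := by
  obtain ⟨C, hC, hg⟩ := g_bound n hn a b ha hb
  refine ⟨C, hC, fun t0 ht0 v hv hv0 t htt x V hV => ?_⟩
  have ht : 4 ≤ t := by linarith
  have hlt : 0 < Real.log t := Real.log_pos (by linarith)
  set A := (max (Real.sqrt t) ‖x‖) ^ (-b) * Real.log t ^ (-a) with hA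
  set B := t ^ (-(n : ℝ) / 2) * Real.exp (-‖x‖ ^ 2 / (8 * t)) with hB
  have hA0 : 0 ≤ A := by positivity
  have hB0 : 0 ≤ B := by positivity
  have hD0 : 0 ≤ DD n a b t := by
    unfold DD; split_ifs <;> positivity
  have hgc : ∃ c : ℝ, 0 < c ∧ ∀ s, 4 ≤ s → s ≤ t / 2 → c ≤ ∫ z, kker n a b t x s z := by
    by_cases h8 : 8 ≤ t
    · exact g_lower n hn a b ha hb t x h8
    · exact ⟨1, one_pos, fun s h1 h2 => by linarith⟩
  obtain ⟨c, hc, hgc⟩ := hgc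
  have e : Tout n t0 (fun z s => if Real.sqrt s ≤ ‖z‖
              then v s * ‖z‖ ^ (-b) * Real.log ‖z‖ ^ (-a) else 0) x t =
      ∫ s in t0..t, v s * ∫ z, kker n a b t x s z := by
    unfold Tout
    congr 1
    funext s
    rw [← integral_const_mul]
    congr 1
    funext z
    unfold kker
    simp only
    split_ifs <;> ring
  rw [e]
  refine (time_bound t0 t V (C * A) (C * (B * DD n a b t)) c v
    (fun s => ∫ z, kker n a b t x s z) ht0 htt hv hv0 hV (by positivity) (by positivity)
    ?_ ?_ ?_ ?_ hc hgc).trans (le_of_eq (by ring))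
  · exact (kker_meas n a b t x).stronglyMeasurable.integral_prod_right'
  · exact fun s h1 h2 => integral_nonneg fun z => kker_nonneg n a b t x s z h1 h2
  · exact fun s h1 h2 h3 => (hg t s x h1).1 h2 h3
  · intro s h1 h2
    have := ((hg t s x h1).2 h2).2
    rwa [mul_add] at this

/-- Second convolution estimate (Lemma 2.2(2)): bound on the Duhamel propagator applied to a
source `v(s)|z|^{−b}(log|z|)^{−a} 𝟙_{|z| ≥ √s}` supported in the self-similar exterior region.
The supremum of `v` on `[t/2,t]` is rendered through an arbitrary upper bound `V`. -/
theorem convolution_estimate_exterior (n : ℕ) (hn : 3 ≤ n) (a b : ℝ)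
    (ha : a ∈ Set.Ico (0:ℝ) 1) (hb : b ≤ n) :
    ∃ C : ℝ, 0 < C ∧ ∀ t0 : ℝ, 4 ≤ t0 →
      ∀ v : ℝ → ℝ, (∀ s, 0 ≤ v s) → (∀ s, s < t0 → v s = 0) →
      ∀ t : ℝ, t0 ≤ t → ∀ x : EuclideanSpace ℝ (Fin n),
      ∀ V : ℝ, (∀ s ∈ Set.Icc (t / 2) t, v s ≤ V) →
        (‖x‖ ≤ Real.sqrt t →
          Tout n t0 (fun z s => if Real.sqrt s ≤ ‖z‖
              then v s * ‖z‖ ^ (-b) * Real.log ‖z‖ ^ (-a) else 0) x t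
            ≤ C * (t ^ (-(n : ℝ) / 2) * (∫ s in (t0 / 2)..(t / 2), v s) *
                  (if b < n then t ^ (((n : ℝ) - b) / 2) * Real.log t ^ (-a)
                   else Real.log t ^ (1 - a))
                + t ^ (1 - b / 2) * Real.log t ^ (-a) * V)) ∧
        (Real.sqrt t < ‖x‖ →
          Tout n t0 (fun z s => if Real.sqrt s ≤ ‖z‖
              then v s * ‖z‖ ^ (-b) * Real.log ‖z‖ ^ (-a) else 0) x t
            ≤ C * (‖x‖ ^ (-b) * Real.log t ^ (-a)
                  * (t * V + ∫ s in (t0 / 2)..(t / 2), v s)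
                + (if b < n then 0 else Real.log ‖x‖ ^ (1 - a))
                  * (t ^ (-(n : ℝ) / 2) * Real.exp (-‖x‖ ^ 2 / (16 * t))
                    * ∫ s in (t0 / 2)..(t / 2), v s))) := by
  obtain ⟨C, hC, hT⟩ := Tout_bound n hn a b ha hb
  obtain ⟨C', hC', hR⟩ := aux_ratio b
  refine ⟨C * (2 + C'), by positivity, fun t0 ht0 v hv hv0 t htt x V hV => ?_⟩
  have key := hT t0 ht0 v hv hv0 t htt x V hV
  have hI0 : 0 ≤ ∫ s in (t0 / 2)..(t / 2), v s :=
    intervalIntegral.integral_nonneg (by linarith) fun s _ => hv s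
  have hV0 : 0 ≤ V := (hv t).trans (hV t ⟨by linarith, le_rfl⟩)
  have ht : 4 ≤ t := by linarith
  have ht0' : 0 < t := by linarith
  have hlt1 : 1 ≤ Real.log t := by
    rw [Real.le_log_iff_exp_le ht0']
    linarith [Real.exp_one_lt_d9]
  have hlt : 0 < Real.log t := by linarith
  have ha1 : 0 < 1 - a := by linarith [ha.2]
  have hst0 : 0 < Real.sqrt t := Real.sqrt_pos.mpr ht0'
  set I := ∫ s in (t0 / 2)..(t / 2), v s with hI
  have hD0 : 0 ≤ DD n a b t := by
    unfold DD; split_ifs <;> positivity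
  have hsq : Real.sqrt t ^ (-b) = t ^ (-b / 2) := by
    rw [Real.sqrt_eq_rpow, ← Real.rpow_mul ht0'.le]; congr 1; ring
  have hLa : 0 < Real.log t ^ (-a) := by positivity
  have htn : 0 < t ^ (-(n : ℝ) / 2) := by positivity
  have hDlt : b < n → t ^ (-(n : ℝ) / 2) * DD n a b t = t ^ (-b / 2) * Real.log t ^ (-a) := by
    intro h
    rw [DD, if_pos h, ← mul_assoc, ← Real.rpow_add ht0']
    congr 2; ring
  constructor
  · intro hx
    refine key.trans ?_
    rw [max_eq_left hx, hsq]
    change _ ≤ C * (2 + C') * (t ^ (-(n : ℝ) / 2) * I * DD n a b t + _)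
    have e1 : t ^ (-b / 2) * Real.log t ^ (-a) ≤ t ^ (-(n : ℝ) / 2) * DD n a b t := by
      by_cases h : b < n
      · rw [hDlt h]
      · have hbn : b = n := le_antisymm hb (not_lt.mp h)
        rw [DD, if_neg h, hbn]
        gcongr
        linarith
    have e2 : t ^ (1 - b / 2) = t * t ^ (-b / 2) := by
      rw [show 1 - b / 2 = 1 + -b / 2 by ring, Real.rpow_add ht0', Real.rpow_one]
    have e3 : Real.exp (-‖x‖ ^ 2 / (8 * t)) ≤ 1 := by
      apply Real.exp_le_one_iff.mpr
      rw [neg_div]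
      have : 0 ≤ ‖x‖ ^ 2 / (8 * t) := by positivity
      linarith
    rw [e2]
    set P := t ^ (-b / 2) * Real.log t ^ (-a) with hP
    set Q := t ^ (-(n : ℝ) / 2) * DD n a b t with hQ
    have hP0 : 0 ≤ P := by positivity
    have hQ0 : 0 ≤ Q := by positivity
    rw [mul_assoc C]
    gcongr
    have f1 : t ^ (-(n : ℝ) / 2) * Real.exp (-‖x‖ ^ 2 / (8 * t)) * DD n a b t * I ≤ Q * I := by
      calc _ = Q * I * Real.exp (-‖x‖ ^ 2 / (8 * t)) := by rw [hQ]; ring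
        _ ≤ Q * I * 1 := by gcongr
        _ = _ := by ring
    have f2 : P * I ≤ Q * I := by gcongr
    have f3 : 0 ≤ P * (t * V) := by positivity
    have f4 : 0 ≤ Q * I := by positivity
    have f5 : t ^ (-(n : ℝ) / 2) * I * DD n a b t + t * t ^ (-b / 2) * Real.log t ^ (-a) * V =
        Q * I + P * (t * V) := by rw [hP, hQ]; ring
    rw [f5]
    nlinarith [mul_nonneg hC'.le f3, mul_nonneg hC'.le f4]
  · intro hx
    refine key.trans ?_
    rw [max_eq_right hx.le]
    have hx0 : 0 < ‖x‖ := hst0.trans hx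
    set P := ‖x‖ ^ (-b) * Real.log t ^ (-a) with hP
    have hP0 : 0 ≤ P := by positivity
    have hPV : 0 ≤ P * (t * V + I) := by positivity
    have hPV' : P * I ≤ P * (t * V + I) := by
      have : 0 ≤ t * V := by positivity
      gcongr; linarith
    rw [mul_assoc C]
    gcongr
    by_cases h : b < n
    · rw [if_pos h, zero_mul, add_zero]
      set M := ‖x‖ / Real.sqrt t with hM
      have hM0 : 0 ≤ M := by positivity
      have hMx : ‖x‖ = M * Real.sqrt t := by rw [hM]; field_simp
      have r := hR M ‖x‖ (Real.sqrt t) hM0 hx0 hst0 (by rw [hMx]; nlinarith) (by nlinarith)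
      rw [hsq] at r
      have hM2 : M ^ 2 / 8 = ‖x‖ ^ 2 / (8 * t) := by
        rw [hM, div_pow, Real.sq_sqrt ht0'.le, div_div, mul_comm t 8]
      rw [hM2] at r
      have f1 : t ^ (-(n : ℝ) / 2) * Real.exp (-‖x‖ ^ 2 / (8 * t)) * DD n a b t ≤ C' * P := by
        calc _ = Real.exp (-‖x‖ ^ 2 / (8 * t)) * (t ^ (-(n : ℝ) / 2) * DD n a b t) := by ring
          _ = Real.exp (-‖x‖ ^ 2 / (8 * t)) * (t ^ (-b / 2) * Real.log t ^ (-a)) := by rw [hDlt h]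
          _ ≤ Real.exp (-‖x‖ ^ 2 / (8 * t)) * ((C' * ‖x‖ ^ (-b) * Real.exp (‖x‖ ^ 2 / (8 * t))) *
              Real.log t ^ (-a)) := by gcongr
          _ = C' * P * (Real.exp (-‖x‖ ^ 2 / (8 * t)) * Real.exp (‖x‖ ^ 2 / (8 * t))) := by
              rw [hP]; ring
          _ = _ := by
              rw [← Real.exp_add, neg_div, neg_add_cancel, Real.exp_zero, mul_one]
      have f2 := mul_le_mul_of_nonneg_right f1 hI0
      have f3 := mul_le_mul_of_nonneg_left hPV' hC'.le
      nlinarith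
    · rw [if_neg h]
      have hlx : Real.log t ≤ 2 * Real.log ‖x‖ := by
        have := Real.log_le_log hst0 hx.le
        rw [Real.log_sqrt ht0'.le] at this
        linarith
      have hlx0 : 0 < Real.log ‖x‖ := by linarith
      have f1 : DD n a b t ≤ 2 * Real.log ‖x‖ ^ (1 - a) := by
        rw [DD, if_neg h]
        calc _ ≤ (2 * Real.log ‖x‖) ^ (1 - a) := Real.rpow_le_rpow hlt.le hlx ha1.le
          _ = 2 ^ (1 - a) * Real.log ‖x‖ ^ (1 - a) := Real.mul_rpow (by norm_num) hlx0.le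
          _ ≤ _ := by
              gcongr
              have := Real.rpow_le_rpow_of_exponent_le (show (1:ℝ) ≤ 2 by norm_num)
                (show 1 - a ≤ 1 by linarith [ha.1])
              simpa using this
      have f2 : Real.exp (-‖x‖ ^ 2 / (8 * t)) ≤ Real.exp (-‖x‖ ^ 2 / (16 * t)) := by
        apply Real.exp_le_exp.mpr
        rw [neg_div, neg_div, neg_le_neg_iff]
        apply div_le_div_of_nonneg_left (by positivity) (by positivity); linarith
      set S := Real.log ‖x‖ ^ (1 - a) * (t ^ (-(n : ℝ) / 2) * Real.exp (-‖x‖ ^ 2 / (16 * t)) * I)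
        with hS
      have hS0 : 0 ≤ S := by positivity
      have f3 : t ^ (-(n : ℝ) / 2) * Real.exp (-‖x‖ ^ 2 / (8 * t)) * DD n a b t * I ≤ 2 * S := by
        calc _ ≤ t ^ (-(n : ℝ) / 2) * Real.exp (-‖x‖ ^ 2 / (16 * t)) *
              (2 * Real.log ‖x‖ ^ (1 - a)) * I := by gcongr
          _ = _ := by rw [hS]; ring
      nlinarith [mul_nonneg hC'.le hS0, mul_nonneg hC'.le hPV]
end

section
/- Let n ≥ 1 be an integer, a ∈ [0,1) and 0 ≤ b < n. There is a constant C = C(n,a,b) such that the following holds. Let Θ₀ : ℝⁿ → ℝ be measurable with |Θ₀(y)| ≤ ⟨y⟩^{−b} (log(2+|y|))^{−a} for all y, and define Θ(x,t) := (4πt)^{−n/2} ∫_{ℝⁿ} e^{−|x−y|²/(4t)} Θ₀(y) dy for t > 0. Then for all t > 0 and x ∈ ℝⁿ: |Θ(x,t)| ≤ C ⟨t⟩^{−b/2} (log(2+t))^{−a} if |x| ≤ max(1, √t), and |Θ(x,t)| ≤ C ⟨x⟩^{−b} (log(2+|x|))^{−a} if |x| > max(1, √t). -/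
open MeasureTheory

/-- The weight. -/
noncomputable def hsW (a b r : ℝ) : ℝ := Real.sqrt (1 + r ^ 2) ^ (-b) * Real.log (2 + r) ^ (-a)

/-- The truncated singular profile. -/
noncomputable def hsPhi (β : ℝ) : ℝ → ℝ := (Set.Iio (1:ℝ)).indicator (fun r => r ^ (-β))

lemma hs_log_pos {r : ℝ} (hr : 0 ≤ r) : 0 < Real.log (2 + r) := Real.log_pos (by linarith)

lemma hsW_pos (a b : ℝ) {r : ℝ} (hr : 0 ≤ r) : 0 < hsW a b r := by
  unfold hsW
  have := hs_log_pos hr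
  positivity

lemma hsW_anti {a b r R : ℝ} (ha : 0 ≤ a) (hb : 0 ≤ b) (hr : 0 ≤ r) (hR : r ≤ R) :
    hsW a b R ≤ hsW a b r := by
  unfold hsW
  have h1 := hs_log_pos hr
  have h2 := hs_log_pos (hr.trans hR)
  apply mul_le_mul
  · apply Real.rpow_le_rpow_of_nonpos (by positivity) _ (by linarith)
    apply Real.sqrt_le_sqrt; gcongr
  · apply Real.rpow_le_rpow_of_nonpos h1 _ (by linarith)
    gcongr
  · positivity
  · positivity

lemma hs_log_ratio {ε r R : ℝ} (hε : 0 < ε) (hr : 0 < r) (hR : r ≤ R) :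
    Real.log (2 + R) / Real.log (2 + r) ≤ (1 + 1 / (ε * Real.log 2)) * (R / r) ^ ε := by
  have h1 := hs_log_pos hr.le
  have hR0 : 0 < R := lt_of_lt_of_le hr hR
  have hl2 : 0 < Real.log 2 := Real.log_pos (by norm_num)
  have h2 : Real.log 2 ≤ Real.log (2 + r) := Real.log_le_log (by norm_num) (by linarith)
  have hone : 1 ≤ (R / r) ^ ε := Real.one_le_rpow ((one_le_div hr).2 hR) hε.le
  have h3 : Real.log (2 + R) = Real.log (2 + r) + Real.log ((2 + R) / (2 + r)) := by
    rw [Real.log_div (by positivity) (by positivity)]; ring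
  have h4 : Real.log ((2 + R) / (2 + r)) ≤ (R / r) ^ ε / ε := by
    refine (Real.log_le_log (by positivity) ?_).trans (Real.log_le_rpow_div (by positivity) hε)
    rw [div_le_div_iff₀ (by positivity) hr]
    nlinarith
  rw [div_le_iff₀ h1, h3]
  have h5 : (R / r) ^ ε / ε ≤ 1 / (ε * Real.log 2) * (R / r) ^ ε * Real.log (2 + r) := by
    have : (R / r) ^ ε / ε = 1 / (ε * Real.log 2) * (R / r) ^ ε * Real.log 2 := by
      field_simp
    rw [this]; gcongr
  nlinarith

lemma hsW_ratio {a b β : ℝ} (ha : 0 ≤ a) (ha1 : a ≤ 1) (hb : 0 ≤ b) (hβ : b < β) :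
    ∃ D : ℝ, 1 ≤ D ∧ ∀ r R : ℝ, 0 < r → r ≤ R → hsW a b r ≤ D * hsW a b R * (r / R) ^ (-β) := by
  have hl2 : 0 < Real.log 2 := Real.log_pos (by norm_num)
  have hε : 0 < β - b := by linarith
  refine ⟨1 + 1 / ((β - b) * Real.log 2), le_add_of_nonneg_right (by positivity), ?_⟩
  intro r R hr hR
  have hR0 : 0 < R := lt_of_lt_of_le hr hR
  have h1 := hs_log_pos hr.le
  have h2 := hs_log_pos hR0.le
  have hle : Real.log (2 + r) ≤ Real.log (2 + R) := Real.log_le_log (by positivity) (by linarith)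
  have key := hs_log_ratio hε hr hR
  set D := 1 + 1 / ((β - b) * Real.log 2)
  have hA : (Real.log (2 + R) / Real.log (2 + r)) ^ a ≤ D * (R / r) ^ (β - b) := by
    refine le_trans ?_ key
    conv_rhs => rw [← Real.rpow_one (Real.log (2 + R) / Real.log (2 + r))]
    exact Real.rpow_le_rpow_of_exponent_le ((one_le_div h1).2 hle) ha1
  have hB : (Real.sqrt (1 + R ^ 2) / Real.sqrt (1 + r ^ 2)) ^ b ≤ (R / r) ^ b := by
    apply Real.rpow_le_rpow (by positivity) _ hb
    rw [← Real.sqrt_div (by positivity)]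
    apply Real.sqrt_le_iff.2 ⟨by positivity, _⟩
    rw [div_pow, div_le_div_iff₀ (by positivity) (by positivity)]
    nlinarith
  have e1 : hsW a b r = hsW a b R * ((Real.sqrt (1 + R ^ 2) / Real.sqrt (1 + r ^ 2)) ^ b *
      (Real.log (2 + R) / Real.log (2 + r)) ^ a) := by
    unfold hsW
    have p1 : 0 < Real.sqrt (1 + R ^ 2) := by positivity
    have p2 : 0 < Real.sqrt (1 + r ^ 2) := by positivity
    rw [Real.div_rpow p1.le p2.le, Real.div_rpow h2.le h1.le, Real.rpow_neg p1.le,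
      Real.rpow_neg p2.le, Real.rpow_neg h1.le, Real.rpow_neg h2.le]
    have := Real.rpow_pos_of_pos p1 b
    have := Real.rpow_pos_of_pos p2 b
    have := Real.rpow_pos_of_pos h1 a
    have := Real.rpow_pos_of_pos h2 a
    field_simp
  have e2 : (r / R) ^ (-β) = (R / r) ^ b * (R / r) ^ (β - b) := by
    rw [← Real.rpow_add (by positivity), Real.rpow_neg (by positivity),
      ← Real.inv_rpow (by positivity), inv_div]
    congr 1; ring
  rw [e1, e2]
  have hw := hsW_pos a b hR0.le
  calc _ ≤ hsW a b R * ((R / r) ^ b * (D * (R / r) ^ (β - b))) := by gcongr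
    _ = _ := by ring

lemma hsPhi_nonneg (β : ℝ) {r : ℝ} (hr : 0 ≤ r) : 0 ≤ hsPhi β r := by
  unfold hsPhi
  by_cases h : r ∈ Set.Iio (1:ℝ)
  · rw [Set.indicator_of_mem h]; positivity
  · rw [Set.indicator_of_notMem h]

lemma hsPhi_integrable {n : ℕ} (hn : 1 ≤ n) {β : ℝ} (hβ : β < n) :
    Integrable (fun y : EuclideanSpace ℝ (Fin n) => hsPhi β ‖y‖) := by
  have : Nonempty (Fin n) := ⟨⟨0, hn⟩⟩
  rw [integrable_fun_norm_addHaar]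
  have h := intervalIntegral.intervalIntegrable_rpow' (a := 0) (b := 1)
    (r := (n:ℝ) - 1 - β) (by linarith)
  rw [intervalIntegrable_iff_integrableOn_Ioo_of_le zero_le_one] at h
  have h2 : IntegrableOn ((Set.Ioo (0:ℝ) 1).indicator fun x => x ^ ((n:ℝ) - 1 - β)) (Set.Ioi 0) :=
    ((integrable_indicator_iff measurableSet_Ioo).2 h).integrableOn
  refine h2.congr_fun ?_ measurableSet_Ioi
  intro y hy
  have hy : 0 < y := hy
  simp only [finrank_euclideanSpace, Fintype.card_fin, smul_eq_mul, hsPhi]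
  by_cases h1 : y < 1
  · rw [Set.indicator_of_mem (show y ∈ Set.Ioo (0:ℝ) 1 from ⟨hy, h1⟩),
      Set.indicator_of_mem (show y ∈ Set.Iio (1:ℝ) from h1), ← Real.rpow_natCast,
      ← Real.rpow_add hy, Nat.cast_sub hn]
    congr 1
    push_cast; ring
  · rw [Set.indicator_of_notMem (fun h => h1 h.2), Set.indicator_of_notMem (show y ∉ Set.Iio (1:ℝ) from h1), mul_zero]

/-- The heat kernel. -/
noncomputable def hsG (n : ℕ) (t : ℝ) (z : EuclideanSpace ℝ (Fin n)) : ℝ :=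
  (4 * Real.pi * t) ^ (-(n : ℝ) / 2) * Real.exp (-‖z‖ ^ 2 / (4 * t))

lemma hsG_nonneg (n : ℕ) {t : ℝ} (ht : 0 < t) (z : EuclideanSpace ℝ (Fin n)) : 0 ≤ hsG n t z := by
  unfold hsG; positivity

lemma hsG_integral (n : ℕ) {t : ℝ} (ht : 0 < t) : ∫ z, hsG n t z = 1 := by
  unfold hsG
  rw [integral_const_mul]
  have := GaussianFourier.integral_rexp_neg_mul_sq_norm (V := EuclideanSpace ℝ (Fin n))
    (b := 1 / (4 * t)) (by positivity)
  have e : ∀ z : EuclideanSpace ℝ (Fin n), -‖z‖ ^ 2 / (4 * t) = -(1 / (4 * t)) * ‖z‖ ^ 2 := by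
    intro z; ring
  simp_rw [e]
  rw [this, finrank_euclideanSpace, Fintype.card_fin]
  have e2 : Real.pi / (1 / (4 * t)) = 4 * Real.pi * t := by field_simp
  rw [e2, ← Real.rpow_add (by positivity)]
  rw [show -(n:ℝ) / 2 + n / 2 = 0 by ring, Real.rpow_zero]

lemma hsG_integrable (n : ℕ) {t : ℝ} (ht : 0 < t) : Integrable (hsG n t) := by
  by_contra h
  have := hsG_integral n ht
  rw [integral_undef h] at this
  norm_num at this

lemma hs_core {n : ℕ} {a b : ℝ} {Θ₀ : EuclideanSpace ℝ (Fin n) → ℝ}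
    (hΘ : ∀ y, |Θ₀ y| ≤ hsW a b ‖y‖) {t : ℝ} (ht : 0 < t) (x : EuclideanSpace ℝ (Fin n))
    {B : ℝ} {g : EuclideanSpace ℝ (Fin n) → ℝ} (hg : Integrable g)
    (h : ∀ᵐ y, hsG n t (x - y) * hsW a b ‖y‖ ≤ B * (hsG n t (x - y) + g y)) :
    |(4 * Real.pi * t) ^ (-(n : ℝ) / 2) * ∫ y, Real.exp (-‖x - y‖ ^ 2 / (4 * t)) * Θ₀ y|
      ≤ B * (1 + ∫ y, g y) := by
  have hi : Integrable (fun y => hsG n t (x - y)) := (hsG_integrable n ht).comp_sub_left x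
  have e : ∫ y, B * (hsG n t (x - y) + g y) = B * (1 + ∫ y, g y) := by
    rw [integral_const_mul, integral_add hi hg, integral_sub_left_eq_self (hsG n t),
      hsG_integral n ht]
  rw [← integral_const_mul, ← e, ← Real.norm_eq_abs]
  apply norm_integral_le_of_norm_le ((hi.add hg).const_mul B)
  filter_upwards [h] with y hy
  rw [← mul_assoc, norm_mul]
  refine le_trans ?_ hy
  change ‖hsG n t (x - y)‖ * _ ≤ _
  rw [Real.norm_of_nonneg (hsG_nonneg n ht _), Real.norm_eq_abs]
  exact mul_le_mul_of_nonneg_left (hΘ y) (hsG_nonneg n ht _)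

lemma hs_main {n : ℕ} (hn : 1 ≤ n) {a b : ℝ} (ha : 0 ≤ a) (ha1 : a ≤ 1) (hb : 0 ≤ b)
    (hbn : b < n) {K : ℝ} (hK : 0 ≤ K) :
    ∃ C : ℝ, 0 < C ∧ ∀ Θ₀ : EuclideanSpace ℝ (Fin n) → ℝ, (∀ y, |Θ₀ y| ≤ hsW a b ‖y‖) →
      ∀ t : ℝ, 0 < t → ∀ (x : EuclideanSpace ℝ (Fin n)) (R : ℝ), 0 < R →
      (∀ y, ‖y‖ < R / 2 → hsG n t (x - y) ≤ K * (R / 2) ^ (-(n:ℝ))) →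
      |(4 * Real.pi * t) ^ (-(n : ℝ) / 2) * ∫ y, Real.exp (-‖x - y‖ ^ 2 / (4 * t)) * Θ₀ y|
        ≤ C * hsW a b R := by
  have : Nonempty (Fin n) := ⟨⟨0, hn⟩⟩
  obtain ⟨β, hβ, hβn⟩ := exists_between hbn
  obtain ⟨D, hD, hDW⟩ := hsW_ratio ha ha1 hb hβ
  set I := ∫ y : EuclideanSpace ℝ (Fin n), hsPhi β ‖y‖ with hI
  have hI0 : 0 ≤ I := integral_nonneg fun y => hsPhi_nonneg β (norm_nonneg y)
  have hPi := hsPhi_integrable hn hβn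
  refine ⟨D * (D * (1 / 2 : ℝ) ^ (-β)) * (1 + K * I), by positivity, ?_⟩
  intro Θ₀ hΘ t ht x R hR hker
  have hρ : 0 < R / 2 := by positivity
  have hW2 := hDW (R / 2) R hρ (by linarith)
  rw [show R / 2 / R = 1 / 2 by field_simp] at hW2
  set ρ := R / 2
  have hgi : Integrable (fun y : EuclideanSpace ℝ (Fin n) =>
      K * ρ ^ (-(n:ℝ)) * hsPhi β ‖ρ⁻¹ • y‖) :=
    (hPi.comp_smul (R := ρ⁻¹) (by positivity)).const_mul _
  have hc := hs_core hΘ ht x (B := D * hsW a b ρ) hgi ?_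
  · have eI : ∫ y : EuclideanSpace ℝ (Fin n), K * ρ ^ (-(n:ℝ)) * hsPhi β ‖ρ⁻¹ • y‖ = K * I := by
      rw [integral_const_mul,
        Measure.integral_comp_inv_smul_of_nonneg volume (fun y => hsPhi β ‖y‖) hρ.le,
        finrank_euclideanSpace, Fintype.card_fin, Real.rpow_neg hρ.le, Real.rpow_natCast,
        smul_eq_mul]
      field_simp
      rw [hI]
    rw [eI] at hc
    refine hc.trans ?_
    calc _ ≤ D * (D * hsW a b R * (1 / 2) ^ (-β)) * (1 + K * I) := by gcongr
      _ = _ := by ring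
  · filter_upwards [Measure.ae_ne volume (0 : EuclideanSpace ℝ (Fin n))] with y hy
    have hy0 : 0 < ‖y‖ := norm_pos_iff.2 hy
    have hG := hsG_nonneg n ht (x - y)
    have hw := hsW_pos a b hρ.le
    have hw' := hsW_pos a b hy0.le
    have hn1 : ‖ρ⁻¹ • y‖ = ‖y‖ / ρ := by
      rw [norm_smul, Real.norm_of_nonneg (by positivity)]; field_simp
    by_cases hyR : ‖y‖ < ρ
    · have h1 := hDW _ _ hy0 hyR.le
      have h2 := hker y hyR
      have h3 : hsPhi β ‖ρ⁻¹ • y‖ = (‖y‖ / ρ) ^ (-β) := by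
        rw [hn1, hsPhi, Set.indicator_of_mem]
        exact (div_lt_one hρ).2 hyR
      rw [h3]
      calc _ ≤ (K * ρ ^ (-(n:ℝ))) * (D * hsW a b ρ * (‖y‖ / ρ) ^ (-β)) := by gcongr
        _ = D * hsW a b ρ * (0 + K * ρ ^ (-(n:ℝ)) * (‖y‖ / ρ) ^ (-β)) := by ring
        _ ≤ _ := by gcongr
    · have h1 := hsW_anti ha hb hρ.le (not_lt.1 hyR)
      have h3 : hsPhi β ‖ρ⁻¹ • y‖ = 0 := by
        rw [hn1, hsPhi, Set.indicator_of_notMem]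
        intro h
        exact hyR ((div_lt_one hρ).1 h)
      rw [h3, mul_zero, add_zero]
      calc _ ≤ hsG n t (x - y) * (1 * hsW a b ρ) := by rw [one_mul]; gcongr
        _ ≤ hsG n t (x - y) * (D * hsW a b ρ) := by gcongr
        _ = _ := by ring

lemma hs_prefactor (n : ℕ) {t : ℝ} (ht : 0 < t) :
    (4 * Real.pi * t) ^ (-(n : ℝ) / 2) ≤ t ^ (-(n : ℝ) / 2) := by
  apply Real.rpow_le_rpow_of_nonpos ht
  · nlinarith [Real.pi_gt_three]
  · have : (0:ℝ) ≤ n := n.cast_nonneg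
    linarith

lemma hs_sq_rpow (n : ℕ) {R : ℝ} (hR : 0 < R) : (R ^ 2) ^ (-(n : ℝ) / 2) = R ^ (-(n:ℝ)) := by
  rw [← Real.rpow_natCast R 2, ← Real.rpow_mul hR.le]
  congr 1; push_cast; ring

lemma hs_half_rpow (n : ℕ) {R : ℝ} (hR : 0 < R) : R ^ (-(n : ℝ)) ≤ (R / 2) ^ (-(n:ℝ)) := by
  apply Real.rpow_le_rpow_of_nonpos (by positivity) (by linarith)
  have : (0:ℝ) ≤ n := n.cast_nonneg
  linarith

lemma hs_ker_near (n : ℕ) {t : ℝ} (ht : 0 < t) (z : EuclideanSpace ℝ (Fin n)) :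
    hsG n t z ≤ (Real.sqrt t / 2) ^ (-(n:ℝ)) := by
  have hs := Real.sqrt_pos.2 ht
  refine le_trans ?_ (hs_half_rpow n hs)
  rw [← hs_sq_rpow n hs, Real.sq_sqrt ht.le]
  refine le_trans ?_ (hs_prefactor n ht)
  unfold hsG
  apply mul_le_of_le_one_right (by positivity)
  apply Real.exp_le_one_iff.2
  rw [neg_div]
  have : 0 ≤ ‖z‖ ^ 2 / (4 * t) := by positivity
  linarith

lemma hs_ker_far {n : ℕ} (hn : 1 ≤ n) {t : ℝ} (ht : 0 < t) {x y : EuclideanSpace ℝ (Fin n)}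
    (hx : 0 < ‖x‖) (hy : ‖y‖ < ‖x‖ / 2) :
    hsG n t (x - y) ≤ (8 * n : ℝ) ^ ((n:ℝ) / 2) * (‖x‖ / 2) ^ (-(n:ℝ)) := by
  have hn0 : (0:ℝ) < n := by exact_mod_cast hn
  have hz : ‖x‖ / 2 ≤ ‖x - y‖ := by
    have := norm_sub_norm_le x y
    linarith
  set R := ‖x‖
  have h1 : Real.exp (-‖x - y‖ ^ 2 / (4 * t)) ≤ Real.exp (-(R ^ 2 / (16 * t))) := by
    apply Real.exp_le_exp.2
    have : R ^ 2 / (16 * t) = (R / 2) ^ 2 / (4 * t) := by field_simp; ring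
    rw [this, neg_div, neg_le_neg_iff]
    gcongr
  have h2 : (R ^ 2 / t / (8 * n)) ^ ((n:ℝ) / 2) ≤ Real.exp (R ^ 2 / (16 * t)) := by
    have e : R ^ 2 / (16 * t) = (R ^ 2 / t / (8 * n)) * ((n:ℝ) / 2) := by field_simp; ring
    rw [e, Real.exp_mul]
    apply Real.rpow_le_rpow (by positivity) _ (by positivity)
    have := Real.add_one_le_exp (R ^ 2 / t / (8 * n))
    linarith
  have h3 : Real.exp (-(R ^ 2 / (16 * t))) ≤ (R ^ 2 / t / (8 * n)) ^ (-(n:ℝ) / 2) := by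
    rw [Real.exp_neg, neg_div, Real.rpow_neg (by positivity)]
    exact inv_anti₀ (by positivity) h2
  calc hsG n t (x - y) ≤ t ^ (-(n : ℝ) / 2) * (R ^ 2 / t / (8 * n)) ^ (-(n:ℝ) / 2) := by
        unfold hsG
        exact mul_le_mul (hs_prefactor n ht) (h1.trans h3) (by positivity) (by positivity)
    _ = (8 * n : ℝ) ^ ((n:ℝ) / 2) * R ^ (-(n:ℝ)) := by
        rw [← hs_sq_rpow n hx, ← Real.mul_rpow (by positivity) (by positivity),
          show t * (R ^ 2 / t / (8 * n)) = (8 * (n:ℝ))⁻¹ * R ^ 2 by field_simp,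
          Real.mul_rpow (by positivity) (by positivity), Real.inv_rpow (by positivity), neg_div,
          Real.rpow_neg (x := 8 * (n:ℝ)) (by positivity), inv_inv]
    _ ≤ _ := mul_le_mul_of_nonneg_left (hs_half_rpow n hx) (by positivity)

lemma hs_compare {a b t : ℝ} (ha : 0 ≤ a) (hb : 0 ≤ b) (ht : 0 < t) :
    hsW a b (Real.sqrt t) ≤
      2 ^ a * (Real.sqrt (1 + t ^ 2) ^ (-(b / 2)) * Real.log (2 + t) ^ (-a)) := by
  unfold hsW
  have hs := Real.sqrt_pos.2 ht
  have hsq := Real.sq_sqrt ht.le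
  have h1 := hs_log_pos hs.le
  have h2 := hs_log_pos ht.le
  have hA : Real.sqrt (1 + Real.sqrt t ^ 2) ^ (-b) ≤ Real.sqrt (1 + t ^ 2) ^ (-(b / 2)) := by
    rw [hsq]
    have e : Real.sqrt (1 + t) ^ (-b) = (1 + t) ^ (-(b / 2)) := by
      rw [Real.sqrt_eq_rpow, ← Real.rpow_mul (by positivity)]
      congr 1; ring
    rw [e]
    apply Real.rpow_le_rpow_of_nonpos (by positivity) _ (by linarith)
    apply Real.sqrt_le_iff.2 ⟨by positivity, by nlinarith⟩
  have hB : Real.log (2 + Real.sqrt t) ^ (-a) ≤ 2 ^ a * Real.log (2 + t) ^ (-a) := by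
    have e : 2 ^ a * Real.log (2 + t) ^ (-a) = (Real.log (2 + t) / 2) ^ (-a) := by
      rw [Real.div_rpow h2.le (by norm_num), Real.rpow_neg (x := 2) (by norm_num)]
      field_simp
    rw [e]
    apply Real.rpow_le_rpow_of_nonpos (by positivity) _ (by linarith)
    have : Real.log (2 + t) ≤ Real.log ((2 + Real.sqrt t) ^ 2) :=
      Real.log_le_log (by positivity) (by nlinarith)
    rw [Real.log_pow] at this
    push_cast at this
    linarith
  calc _ ≤ Real.sqrt (1 + t ^ 2) ^ (-(b / 2)) * (2 ^ a * Real.log (2 + t) ^ (-a)) := by gcongr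
    _ = _ := by ring

/-- Heat-semigroup decay estimate (Lemma 2.3): if `|Θ₀(y)| ≤ ⟨y⟩^{−b}(log(2+|y|))^{−a}`, then
the solution `Θ(x,t) = (4πt)^{−n/2} ∫ e^{−|x−y|²/(4t)} Θ₀(y) dy` of the heat equation satisfies
`|Θ(x,t)| ≤ C⟨t⟩^{−b/2}(log(2+t))^{−a}` for `|x| ≤ max(1,√t)` and
`|Θ(x,t)| ≤ C⟨x⟩^{−b}(log(2+|x|))^{−a}` for `|x| > max(1,√t)`. -/
theorem heat_semigroup_decay (n : ℕ) (hn : 1 ≤ n) (a b : ℝ)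
    (ha : a ∈ Set.Ico (0:ℝ) 1) (hb0 : 0 ≤ b) (hbn : b < n) :
    ∃ C : ℝ, 0 < C ∧
      ∀ Θ₀ : EuclideanSpace ℝ (Fin n) → ℝ, Measurable Θ₀ →
        (∀ y, |Θ₀ y| ≤ Real.sqrt (1 + ‖y‖ ^ 2) ^ (-b) * Real.log (2 + ‖y‖) ^ (-a)) →
      ∀ t : ℝ, 0 < t → ∀ x : EuclideanSpace ℝ (Fin n),
        (‖x‖ ≤ max 1 (Real.sqrt t) →
          |(4 * Real.pi * t) ^ (-(n : ℝ) / 2)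
              * ∫ y, Real.exp (-‖x - y‖ ^ 2 / (4 * t)) * Θ₀ y|
            ≤ C * Real.sqrt (1 + t ^ 2) ^ (-(b / 2)) * Real.log (2 + t) ^ (-a)) ∧
        (max 1 (Real.sqrt t) < ‖x‖ →
          |(4 * Real.pi * t) ^ (-(n : ℝ) / 2)
              * ∫ y, Real.exp (-‖x - y‖ ^ 2 / (4 * t)) * Θ₀ y|
            ≤ C * Real.sqrt (1 + ‖x‖ ^ 2) ^ (-b) * Real.log (2 + ‖x‖) ^ (-a)) := by
  have ha0 : 0 ≤ a := ha.1
  have hK : (0:ℝ) ≤ 1 + (8 * n : ℝ) ^ ((n:ℝ) / 2) := by positivity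
  obtain ⟨C₁, hC₁, hmain⟩ := hs_main hn ha0 ha.2.le hb0 hbn hK
  refine ⟨C₁ * 2 ^ a + C₁, by positivity, ?_⟩
  intro Θ₀ _ hΘ t ht x
  have hΘ' : ∀ y, |Θ₀ y| ≤ hsW a b ‖y‖ := hΘ
  constructor
  · intro _
    have hl := hs_log_pos ht.le
    rw [mul_assoc (_ + C₁)]
    set P := Real.sqrt (1 + t ^ 2) ^ (-(b / 2)) * Real.log (2 + t) ^ (-a) with hP
    have hP0 : 0 < P := by positivity
    have hcmp : hsW a b (Real.sqrt t) ≤ 2 ^ a * P := hs_compare ha0 hb0 ht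
    have hfin : C₁ * hsW a b (Real.sqrt t) ≤ (C₁ * 2 ^ a + C₁) * P := by
      calc _ ≤ C₁ * (2 ^ a * P) := by gcongr
        _ ≤ C₁ * (2 ^ a * P) + C₁ * P := by
          have : 0 ≤ C₁ * P := by positivity
          linarith
        _ = _ := by ring
    refine le_trans ?_ hfin
    have hs := Real.sqrt_pos.2 ht
    have hw := hsW_pos a b hs.le
    have h := hmain Θ₀ hΘ' t ht x (Real.sqrt t) hs ?_
    · exact h
    · intro y _
      refine (hs_ker_near n ht _).trans (le_mul_of_one_le_left (by positivity) ?_)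
      have : (0:ℝ) ≤ (8 * n : ℝ) ^ ((n:ℝ) / 2) := by positivity
      linarith
  · intro hx
    have hx0 : 0 < ‖x‖ := lt_trans zero_lt_one ((le_max_left _ _).trans_lt hx)
    have hw := hsW_pos a b hx0.le
    have h := hmain Θ₀ hΘ' t ht x ‖x‖ hx0 ?_
    · refine h.trans ?_
      rw [mul_assoc]
      change _ ≤ _ * hsW a b ‖x‖
      gcongr
      have : 0 ≤ C₁ * 2 ^ a := by positivity
      linarith
    · intro y hy
      refine (hs_ker_far hn ht hx0 hy).trans ?_
      gcongr
      linarith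
end
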